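/- Let x, z, r be unit vectors in ℂ² and p ∈ [0,1]. Set a = |⟨r, x⟩|², b = |⟨r, z⟩|², c = |⟨x, z⟩|², and assume c ≥ 1/2. Then H(a·p + (1−a)·(1−p)) + H(b·p + (1−b)·(1−p)) ≥ H(p) + H(√c·p + (1−√c)·(1−p)) ≥ 2·H(p), where H is the binary entropy function; in particular the sum of entropies of the two measurement outcome distributions, H(X) + H(Z), is at least H((√(2P−1)(2√c−1)+1)/2) + H(ρ), where P = 2p² − 2p + 1 is the purity and H(ρ) = H(p) is the von Neumann entropy. -/

import Mathlib

open scoped InnerProductSpace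

lemma aux_abs (t : ℝ) : Real.binEntropy ((1 + t) / 2) = Real.binEntropy ((1 + |t|) / 2) := by
  rcases abs_cases t with ⟨h, _⟩ | ⟨h, _⟩
  · rw [h]
  · rw [h, ← Real.binEntropy_one_sub]
    congr 1
    ring

lemma aux_anti {u v : ℝ} (hu : 0 ≤ u) (huv : u ≤ v) (hv : v ≤ 1) :
    Real.binEntropy ((1 + v) / 2) ≤ Real.binEntropy ((1 + u) / 2) := by
  apply Real.binEntropy_strictAntiOn.antitoneOn
  · constructor <;> norm_num <;> linarith
  · constructor <;> norm_num <;> linarith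
  · linarith

lemma aux_conc {S w u : ℝ} (hw : 0 ≤ w) (hwu : w ≤ u) (huS : u ≤ S) (hS : S ≤ 1) :
    Real.binEntropy ((1 + S) / 2) + Real.binEntropy ((1 + w) / 2)
      ≤ Real.binEntropy ((1 + u) / 2) + Real.binEntropy ((1 + (S + w - u)) / 2) := by
  rcases eq_or_lt_of_le (hwu.trans huS) with h | h
  · have h1 : u = S := by linarith
    subst h1
    simp
  · have hc := Real.strictConcave_binEntropy.concaveOn.2
    have hSm : (1 + S) / 2 ∈ Set.Icc (0 : ℝ) 1 := by constructor <;> linarith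
    have hwm : (1 + w) / 2 ∈ Set.Icc (0 : ℝ) 1 := by constructor <;> linarith
    have hd : 0 < S - w := by linarith
    have hne : S - w ≠ 0 := hd.ne'
    obtain ⟨l, hl⟩ : ∃ l, l = (u - w) / (S - w) := ⟨_, rfl⟩
    have hl0 : 0 ≤ l := by rw [hl]; apply div_nonneg <;> linarith
    have hl1 : l ≤ 1 := by rw [hl, div_le_one hd]; linarith
    have hu : l * (S - w) = u - w := by rw [hl]; field_simp
    have h1 := hc hSm hwm hl0 (by linarith : 0 ≤ 1 - l) (by ring)
    have h2 := hc hSm hwm (by linarith : 0 ≤ 1 - l) hl0 (by ring)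
    simp only [smul_eq_mul] at h1 h2
    have e1 : l * ((1 + S) / 2) + (1 - l) * ((1 + w) / 2) = (1 + u) / 2 := by linear_combination hu / 2
    have e2 : (1 - l) * ((1 + S) / 2) + l * ((1 + w) / 2) = (1 + (S + w - u)) / 2 := by
      linear_combination - hu / 2
    rw [e1] at h1
    rw [e2] at h2
    linarith

lemma aux_maj' {S w u v : ℝ} (hw : 0 ≤ w) (hS : S ≤ 1) (hv : 0 ≤ v) (hvu : v ≤ u) (huS : u ≤ S)
    (hs : u + v ≤ S + w) :
    Real.binEntropy ((1 + S) / 2) + Real.binEntropy ((1 + w) / 2)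
      ≤ Real.binEntropy ((1 + u) / 2) + Real.binEntropy ((1 + v) / 2) := by
  by_cases hwS : w ≤ 1
  swap
  · have h2 : ¬ w ≤ 1 := hwS
    have h3 : Real.binEntropy ((1 + w) / 2) ≤ 0 := by
      apply Real.binEntropy_nonpos_of_one_le
      linarith [not_le.1 h2]
    have h4 := aux_anti (hv.trans hvu) huS hS
    have h5 : 0 ≤ Real.binEntropy ((1 + v) / 2) := by
      apply Real.binEntropy_nonneg <;> linarith
    linarith
  rcases le_or_gt v w with h | h
  · have h1 := aux_anti (hv.trans hvu) huS hS
    have h2 := aux_anti hv h hwS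
    linarith
  · have h1 := aux_conc hw (h.le.trans hvu) huS hS
    have h2 : Real.binEntropy ((1 + (S + w - u)) / 2) ≤ Real.binEntropy ((1 + v) / 2) :=
      aux_anti hv (by linarith) (by linarith)
    linarith

lemma aux_maj {S w u v : ℝ} (hw : 0 ≤ w) (hS : S ≤ 1) (hv : 0 ≤ v) (hu : 0 ≤ u) (huS : u ≤ S)
    (hvS : v ≤ S) (hs : u + v ≤ S + w) :
    Real.binEntropy ((1 + S) / 2) + Real.binEntropy ((1 + w) / 2)
      ≤ Real.binEntropy ((1 + u) / 2) + Real.binEntropy ((1 + v) / 2) := by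
  rcases le_total v u with h | h
  · exact aux_maj' hw hS hv h huS hs
  · rw [add_comm (Real.binEntropy ((1 + u) / 2))]
    exact aux_maj' hw hS hu h hvS (by linarith)

lemma aux_cs (a b c x y z : ℝ) (h : a ^ 2 + b ^ 2 + c ^ 2 = 1) :
    (a * x + b * y + c * z) ^ 2 ≤ x ^ 2 + y ^ 2 + z ^ 2 := by
  have : x ^ 2 + y ^ 2 + z ^ 2 = (a ^ 2 + b ^ 2 + c ^ 2) * (x ^ 2 + y ^ 2 + z ^ 2) := by
    rw [h, one_mul]
  rw [this]
  nlinarith [sq_nonneg (a * y - b * x), sq_nonneg (a * z - c * x), sq_nonneg (b * z - c * y)]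

lemma aux_norm (x : EuclideanSpace ℂ (Fin 2)) (hx : ‖x‖ = 1) :
    (x 0).re ^ 2 + (x 0).im ^ 2 + (x 1).re ^ 2 + (x 1).im ^ 2 = 1 := by
  have h := EuclideanSpace.norm_sq_eq x
  rw [hx, Fin.sum_univ_two, Complex.sq_norm, Complex.sq_norm, Complex.normSq_apply,
    Complex.normSq_apply] at h
  linarith

/-- Bloch vector coordinates -/
def bl1 (x : EuclideanSpace ℂ (Fin 2)) : ℝ := 2 * ((x 0).re * (x 1).re + (x 0).im * (x 1).im)
def bl2 (x : EuclideanSpace ℂ (Fin 2)) : ℝ := 2 * ((x 0).re * (x 1).im - (x 0).im * (x 1).re)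
def bl3 (x : EuclideanSpace ℂ (Fin 2)) : ℝ :=
  (x 0).re ^ 2 + (x 0).im ^ 2 - (x 1).re ^ 2 - (x 1).im ^ 2

lemma bl_norm (x : EuclideanSpace ℂ (Fin 2)) (hx : ‖x‖ = 1) :
    bl1 x ^ 2 + bl2 x ^ 2 + bl3 x ^ 2 = 1 := by
  have h := aux_norm x hx
  have : bl1 x ^ 2 + bl2 x ^ 2 + bl3 x ^ 2
      = ((x 0).re ^ 2 + (x 0).im ^ 2 + (x 1).re ^ 2 + (x 1).im ^ 2) ^ 2 := by
    unfold bl1 bl2 bl3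
    ring
  rw [this, h, one_pow]

lemma bl_inner (x y : EuclideanSpace ℂ (Fin 2)) (hx : ‖x‖ = 1) (hy : ‖y‖ = 1) :
    2 * ‖⟪x, y⟫_ℂ‖ ^ 2 - 1 = bl1 x * bl1 y + bl2 x * bl2 y + bl3 x * bl3 y := by
  have h1 := aux_norm x hx
  have h2 := aux_norm y hy
  have h3 : (1 : ℝ) = ((x 0).re ^ 2 + (x 0).im ^ 2 + (x 1).re ^ 2 + (x 1).im ^ 2)
    * ((y 0).re ^ 2 + (y 0).im ^ 2 + (y 1).re ^ 2 + (y 1).im ^ 2) := by rw [h1, h2, one_mul]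
  rw [h3, Complex.sq_norm, Complex.normSq_apply, PiLp.inner_apply, Fin.sum_univ_two]
  simp only [RCLike.inner_apply, Complex.add_re, Complex.add_im, Complex.mul_re, Complex.mul_im,
    Complex.conj_re, Complex.conj_im]
  unfold bl1 bl2 bl3
  ring

/-- Qubit quantum uncertainty relation chain for the relative entropy of coherence:
for unit vectors `x, z, r` in `ℂ²`, `p ∈ [0,1]`, `a = |⟨r,x⟩|²`, `b = |⟨r,z⟩|²`,
`c = |⟨x,z⟩|² ≥ 1/2`, one has
`H(X) + H(Z) ≥ H(p) + H(√c·p + (1-√c)(1-p)) ≥ 2H(p)`, and in particular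
`H(X) + H(Z) ≥ H((√(2P-1)(2√c-1)+1)/2) + H(p)` with `P = 2p² - 2p + 1`. -/
theorem stmt17 (x z r : EuclideanSpace ℂ (Fin 2)) (p : ℝ) (hp : p ∈ Set.Icc (0 : ℝ) 1)
    (hx : ‖x‖ = 1) (hz : ‖z‖ = 1) (hr : ‖r‖ = 1)
    (a b c : ℝ)
    (ha : a = ‖⟪r, x⟫_ℂ‖ ^ 2) (hb : b = ‖⟪r, z⟫_ℂ‖ ^ 2) (hc : c = ‖⟪x, z⟫_ℂ‖ ^ 2)
    (hc2 : (1/2 : ℝ) ≤ c)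
    (P : ℝ) (hP : P = 2 * p ^ 2 - 2 * p + 1) :
    (Real.binEntropy p
        + Real.binEntropy (Real.sqrt c * p + (1 - Real.sqrt c) * (1 - p))
      ≤ Real.binEntropy (a * p + (1 - a) * (1 - p))
        + Real.binEntropy (b * p + (1 - b) * (1 - p))) ∧
    (2 * Real.binEntropy p
      ≤ Real.binEntropy p
        + Real.binEntropy (Real.sqrt c * p + (1 - Real.sqrt c) * (1 - p))) ∧
    (Real.binEntropy
        ((Real.sqrt (2 * P - 1) * (2 * Real.sqrt c - 1) + 1) / 2)
        + Real.binEntropy p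
      ≤ Real.binEntropy (a * p + (1 - a) * (1 - p))
        + Real.binEntropy (b * p + (1 - b) * (1 - p))) := by
  obtain ⟨hp0, hp1⟩ := hp
  have hα := bl_inner r x hr hx
  have hβ := bl_inner r z hr hz
  have hγ := bl_inner x z hx hz
  rw [← ha] at hα
  rw [← hb] at hβ
  rw [← hc] at hγ
  have nx := bl_norm x hx
  have nz := bl_norm z hz
  have nr := bl_norm r hr
  have cα := aux_cs _ _ _ (bl1 x) (bl2 x) (bl3 x) nr
  have cβ := aux_cs _ _ _ (bl1 z) (bl2 z) (bl3 z) nr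
  have cγ := aux_cs _ _ _ (bl1 z) (bl2 z) (bl3 z) nx
  rw [← hα, nx] at cα
  rw [← hβ, nz] at cβ
  rw [← hγ, nz] at cγ
  have cp := aux_cs _ _ _ (bl1 x + bl1 z) (bl2 x + bl2 z) (bl3 x + bl3 z) nr
  have cm := aux_cs _ _ _ (bl1 x - bl1 z) (bl2 x - bl2 z) (bl3 x - bl3 z) nr
  have hplus : ((2 * a - 1) + (2 * b - 1)) ^ 2 ≤ 4 * c := by
    rw [hα, hβ]
    refine (le_of_eq ?_).trans (cp.trans (le_of_eq ?_))
    · ring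
    · linear_combination nx + nz - 2 * hγ
  have hminus : ((2 * a - 1) - (2 * b - 1)) ^ 2 ≤ 4 * c := by
    rw [hα, hβ]
    refine (le_of_eq ?_).trans (cm.trans ?_)
    · ring
    · linarith [nx, nz, hγ]
  have hc1 : c ≤ 1 := by
    have := (abs_le_one_iff_mul_self_le_one.2 (by linarith [sq (2 * c - 1)]) : |2 * c - 1| ≤ 1)
    linarith [(abs_le.1 this).2]
  clear cp cm hα hβ hγ nx nz nr cγ
  obtain ⟨k, hk⟩ : ∃ k, k = Real.sqrt c := ⟨_, rfl⟩
  have hk0 : 0 ≤ k := hk ▸ Real.sqrt_nonneg c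
  have hk2 : k ^ 2 = c := by rw [hk]; exact Real.sq_sqrt (by linarith)
  have hk1 : k ≤ 1 := by nlinarith
  have hkh : 1 / 2 ≤ k := by nlinarith
  have habs : |2 * a - 1| + |2 * b - 1| ≤ 2 * k := by
    have h1 := abs_le_of_sq_le_sq' (a := (2 * a - 1) + (2 * b - 1)) (b := 2 * k)
      (by nlinarith) (by linarith)
    have h2 := abs_le_of_sq_le_sq' (a := (2 * a - 1) - (2 * b - 1)) (b := 2 * k)
      (by nlinarith) (by linarith)
    rcases abs_cases (2 * a - 1) with ⟨h, _⟩ | ⟨h, _⟩ <;>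
    rcases abs_cases (2 * b - 1) with ⟨h', _⟩ | ⟨h', _⟩ <;> rw [h, h'] <;> linarith [h1.1, h1.2, h2.1, h2.2]
  have ha1 : |2 * a - 1| ≤ 1 := by
    rw [← sq_le_one_iff_abs_le_one]; exact cα
  have hb1 : |2 * b - 1| ≤ 1 := by
    rw [← sq_le_one_iff_abs_le_one]; exact cβ
  have key : ∀ q : ℝ, Real.binEntropy (q * p + (1 - q) * (1 - p))
      = Real.binEntropy ((1 + |2 * p - 1| * |2 * q - 1|) / 2) := by
    intro q
    rw [← abs_mul, ← aux_abs]
    congr 1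
    ring
  have keyp : Real.binEntropy p = Real.binEntropy ((1 + |2 * p - 1|) / 2) := by
    rw [← aux_abs]
    congr 1
    ring
  have hS0 : 0 ≤ |2 * p - 1| := abs_nonneg _
  have hS1 : |2 * p - 1| ≤ 1 := by rw [abs_le]; constructor <;> linarith
  have hkk : |2 * k - 1| = 2 * k - 1 := abs_of_nonneg (by linarith)
  have main : Real.binEntropy p + Real.binEntropy (k * p + (1 - k) * (1 - p))
      ≤ Real.binEntropy (a * p + (1 - a) * (1 - p))
        + Real.binEntropy (b * p + (1 - b) * (1 - p)) := by
    rw [key a, key b, key k, keyp, hkk]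
    apply aux_maj
    · exact mul_nonneg hS0 (by linarith)
    · exact hS1
    · positivity
    · positivity
    · exact mul_le_of_le_one_right hS0 ha1
    · exact mul_le_of_le_one_right hS0 hb1
    · linarith [mul_le_mul_of_nonneg_left habs hS0]
  rw [← hk]
  refine ⟨main, ?_, ?_⟩
  · rw [key k, keyp, hkk]
    have := aux_anti (u := |2 * p - 1| * (2 * k - 1)) (v := |2 * p - 1|)
      (mul_nonneg hS0 (by linarith)) (mul_le_of_le_one_right hS0 (by linarith)) hS1
    linarith
  · have hPs : Real.sqrt (2 * P - 1) = |2 * p - 1| := by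
      rw [← Real.sqrt_sq_eq_abs]
      congr 1
      rw [hP]
      ring
    have e : (|2 * p - 1| * (2 * k - 1) + 1) / 2 = (1 + |2 * p - 1| * |2 * k - 1|) / 2 := by
      rw [hkk]; ring
    rw [hPs, e, ← key k]
    linarith
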